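/- Let k ∈ ℕ, p ∈ [1,∞), and fix q_1,…,q_k ∈ [1,∞) with q_i ≠ p for all i. For each n, let X^{(n)} be a random vector in ℝ^n whose distribution has a density that depends only on ‖x‖_p (a continuous p-radial random vector), and assume √n (1 − ‖X^{(n)}‖_p) → 0 in probability. Then the random vectors √n (n^{1/p−1/q_1} ‖X^{(n)}‖_{q_1}/m_{p,q_1} − 1, …, n^{1/p−1/q_k} ‖X^{(n)}‖_{q_k}/m_{p,q_k} − 1) converge in distribution, as n → ∞, to a centred Gaussian vector N = (N_1,…,N_k) with covariance matrix Σ = (c_{i,j}) given by c_{i,j} = (1/(q_i q_j)) (Γ(1/p) Γ((q_i+q_j+1)/p) / (Γ((q_i+1)/p) Γ((q_j+1)/p)) − 1) − 1/p. -/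

import Mathlib

open MeasureTheory Set Filter
open scoped ENNReal Topology

/-- The `q`-norm on `ℝ^n`. -/
noncomputable def pnorm {n : ℕ} (q : ℝ) (x : Fin n → ℝ) : ℝ :=
  (∑ i, |x i| ^ q) ^ (1 / q)

/-- `M_p(q)`, the `q`-th absolute moment of the `p`-generalized Gaussian distribution. -/
noncomputable def Mp (p q : ℝ) : ℝ :=
  p ^ (q / p) / (q + 1) * (Real.Gamma (1 + (q + 1) / p) / Real.Gamma (1 + 1 / p))

/-- `m_{p,q} = M_p(q)^{1/q}`. -/
noncomputable def mpq (p q : ℝ) : ℝ := Mp p q ^ (1 / q)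

/-- The covariance entries
`c_{i,j} = (1/(q_i q_j)) (Γ(1/p) Γ((q_i+q_j+1)/p)/(Γ((q_i+1)/p) Γ((q_j+1)/p)) − 1) − 1/p`. -/
noncomputable def covEntry (p qi qj : ℝ) : ℝ :=
  1 / (qi * qj) *
      (Real.Gamma (1 / p) * Real.Gamma ((qi + qj + 1) / p) /
          (Real.Gamma ((qi + 1) / p) * Real.Gamma ((qj + 1) / p)) - 1) -
    1 / p

/-- A product formula for lower Lebesgue integrals in which the second factor need not be
measurable. -/
theorem lintegral_prod_mul_of_measurable_left {α β : Type*} [MeasurableSpace α]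
    [MeasurableSpace β] {σ : Measure α} {ρ : Measure β} [SFinite ρ] {f : α → ℝ≥0∞}
    (hf : Measurable f) (hf' : ∀ x, f x ≠ ∞) (h : β → ℝ≥0∞) :
    ∫⁻ z, f z.1 * h z.2 ∂(σ.prod ρ) = (∫⁻ x, f x ∂σ) * ∫⁻ y, h y ∂ρ := by
  apply le_antisymm
  · obtain ⟨w, hw, hwle, hweq⟩ :=
      exists_measurable_le_lintegral_eq (σ.prod ρ) (fun z => f z.1 * h z.2)
    rw [hweq, lintegral_prod w hw.aemeasurable, ← lintegral_mul_const _ hf]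
    refine lintegral_mono fun x => ?_
    rw [← lintegral_const_mul' _ _ (hf' x)]
    exact lintegral_mono fun y => hwle (x, y)
  · obtain ⟨w, hw, hwle, hweq⟩ := exists_measurable_le_lintegral_eq ρ h
    rw [hweq, ← lintegral_prod_mul hf.aemeasurable hw.aemeasurable]
    exact lintegral_mono fun z => mul_le_mul_right (hwle z.2) _

/-- Polar integration of a (not necessarily measurable) function of the norm over a cone. -/
theorem setLIntegral_cone_comp_norm {E : Type*} [NormedAddCommGroup E] [NormedSpace ℝ E]
    [MeasurableSpace E] [BorelSpace E] [FiniteDimensional ℝ E] [Nontrivial E]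
    (μ : Measure E) [μ.IsAddHaarMeasure] {A : Set E} (hA : MeasurableSet A)
    (hcone : ∀ c : ℝ, 0 < c → ∀ x, c • x ∈ A ↔ x ∈ A) (h : ℝ → ℝ≥0∞) :
    ∫⁻ x in A, h ‖x‖ ∂μ = μ.toSphere (Subtype.val ⁻¹' A) *
      ∫⁻ r : Ioi (0 : ℝ), h r ∂(Measure.volumeIoiPow (Module.finrank ℝ E - 1)) := by
  set S : Set (Metric.sphere (0 : E) 1) := Subtype.val ⁻¹' A
  have hS : MeasurableSet S := measurable_subtype_coe hA
  have hmp := μ.measurePreserving_homeomorphUnitSphereProd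
  calc ∫⁻ x in A, h ‖x‖ ∂μ = ∫⁻ x, A.indicator (fun x => h ‖x‖) x ∂μ :=
        (lintegral_indicator hA _).symm
    _ = ∫⁻ x in ({0}ᶜ : Set E), A.indicator (fun x => h ‖x‖) x ∂μ := by
        rw [Measure.restrict_eq_self_of_ae_mem]
        exact compl_mem_ae_iff.2 (measure_singleton _)
    _ = ∫⁻ x : ({0}ᶜ : Set E), A.indicator (fun x => h ‖x‖) (x : E) ∂(μ.comap Subtype.val) :=
        (lintegral_subtype_comap (measurableSet_singleton _).compl _).symm
    _ = ∫⁻ x : ({0}ᶜ : Set E), (fun z : Metric.sphere (0 : E) 1 × Ioi (0 : ℝ) =>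
          S.indicator 1 z.1 * h z.2) (homeomorphUnitSphereProd E x) ∂(μ.comap Subtype.val) := by
        refine lintegral_congr fun x => ?_
        have hx : 0 < ‖(x : E)‖ := norm_pos_iff.2 x.2
        have hmem : (homeomorphUnitSphereProd E x).1 ∈ S ↔ (x : E) ∈ A := by
          simp only [S, mem_preimage, homeomorphUnitSphereProd_apply_fst_coe]
          exact hcone _ (inv_pos.2 hx) _
        by_cases hxA : (x : E) ∈ A
        · simp [hxA, hmem.2 hxA]
        · simp [hxA, mt hmem.1 hxA]
    _ = ∫⁻ z, S.indicator 1 z.1 * h z.2 ∂(μ.toSphere.prod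
          (Measure.volumeIoiPow (Module.finrank ℝ E - 1))) :=
        hmp.lintegral_comp_emb (homeomorphUnitSphereProd E).measurableEmbedding
          (fun z => S.indicator 1 z.1 * h z.2)
    _ = _ := by
        rw [lintegral_prod_mul_of_measurable_left (f := S.indicator 1) (h := fun r : Ioi (0 : ℝ) => h r)
          (measurable_one.indicator hS)
          (fun x => by by_cases hx : x ∈ S <;> simp [hx]), lintegral_indicator_one hS]

/-- The probability of a cone is the same under all norm-radial distributions. -/
theorem withDensity_comp_norm_cone_eq {E : Type*} [NormedAddCommGroup E] [NormedSpace ℝ E]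
    [MeasurableSpace E] [BorelSpace E] [FiniteDimensional ℝ E] [Nontrivial E]
    (μ : Measure E) [μ.IsAddHaarMeasure] {A : Set E} (hA : MeasurableSet A)
    (hcone : ∀ c : ℝ, 0 < c → ∀ x, c • x ∈ A ↔ x ∈ A) (g : ℝ → ℝ≥0∞)
    [hg : IsProbabilityMeasure (μ.withDensity fun x => g ‖x‖)] :
    (μ.withDensity fun x => g ‖x‖) A =
      μ.toSphere (Subtype.val ⁻¹' A) / μ.toSphere univ := by
  have huniv := hg.measure_univ
  rw [withDensity_apply _ MeasurableSet.univ, setLIntegral_cone_comp_norm μ .univ (by simp),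
    preimage_univ] at huniv
  rw [withDensity_apply _ hA, setLIntegral_cone_comp_norm μ hA hcone,
    ENNReal.eq_inv_of_mul_eq_one_left ((mul_comm _ _).trans huniv), div_eq_mul_inv]

theorem pnorm_eq_norm_toLp {n : ℕ} {p : ℝ} (hp : 1 ≤ p) (x : Fin n → ℝ) :
    pnorm p x = ‖WithLp.toLp (ENNReal.ofReal p) x‖ := by
  have hp' : (ENNReal.ofReal p).toReal = p := ENNReal.toReal_ofReal (by linarith)
  rw [PiLp.norm_eq_sum (by rw [hp']; linarith), hp']
  simp [pnorm]

/-- A scale-invariant functional has the same law under all `p`-radial distributions. -/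
theorem map_withDensity_pnorm_eq {n : ℕ} (hn : 0 < n) {p : ℝ} (hp : 1 ≤ p) {F : Type*}
    [MeasurableSpace F] {φ : (Fin n → ℝ) → F} (hφ : Measurable φ)
    (hhom : ∀ c : ℝ, 0 < c → ∀ x, φ (c • x) = φ x) (g₁ g₂ : ℝ → ℝ≥0∞)
    [IsProbabilityMeasure (volume.withDensity fun x : Fin n → ℝ => g₁ (pnorm p x))]
    [IsProbabilityMeasure (volume.withDensity fun x : Fin n → ℝ => g₂ (pnorm p x))] :
    (volume.withDensity fun x : Fin n → ℝ => g₁ (pnorm p x)).map φ =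
      (volume.withDensity fun x : Fin n → ℝ => g₂ (pnorm p x)).map φ := by
  have : Fact (1 ≤ ENNReal.ofReal p) := ⟨by simpa using hp⟩
  have : Nonempty (Fin n) := ⟨⟨0, hn⟩⟩
  set E := PiLp (ENNReal.ofReal p) (fun _ : Fin n => ℝ)
  set e : (Fin n → ℝ) ≃ᵐ E := MeasurableEquiv.toLp (ENNReal.ofReal p) (Fin n → ℝ)
  set L : E ≃L[ℝ] (Fin n → ℝ) :=
    PiLp.continuousLinearEquiv (ENNReal.ofReal p) ℝ (fun _ : Fin n => ℝ)
  set m : Measure E := (volume : Measure (Fin n → ℝ)).map e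
  have : m.IsAddHaarMeasure := L.symm.isAddHaarMeasure_map volume
  have key (g : ℝ → ℝ≥0∞) : volume.withDensity (fun x : Fin n → ℝ => g (pnorm p x)) =
      (m.withDensity fun x => g ‖x‖).map e.symm := by
    ext s hs
    rw [withDensity_apply _ hs, Measure.map_apply e.symm.measurable hs,
      withDensity_apply _ (e.symm.measurable hs), e.measurableEmbedding.restrict_map,
      lintegral_map_equiv, ← preimage_comp]
    simp only [MeasurableEquiv.symm_comp_self, preimage_id]
    exact lintegral_congr fun x => by rw [pnorm_eq_norm_toLp hp]; rfl
  have hprob (g : ℝ → ℝ≥0∞)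
      [IsProbabilityMeasure (volume.withDensity fun x : Fin n → ℝ => g (pnorm p x))] :
      IsProbabilityMeasure (m.withDensity fun x => g ‖x‖) := by
    refine ⟨?_⟩
    rw [← preimage_univ (f := e.symm), ← Measure.map_apply e.symm.measurable .univ, ← key g]
    exact measure_univ
  have := hprob g₁
  have := hprob g₂
  ext B hB
  have hA : MeasurableSet (e.symm ⁻¹' (φ ⁻¹' B)) := e.symm.measurable (hφ hB)
  have hcone : ∀ c : ℝ, 0 < c → ∀ x, c • x ∈ e.symm ⁻¹' (φ ⁻¹' B) ↔ x ∈ e.symm ⁻¹' (φ ⁻¹' B) := by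
    intro c hc x
    have : e.symm (c • x) = c • e.symm x := rfl
    simp only [mem_preimage, this, hhom c hc]
  rw [Measure.map_apply hφ hB, Measure.map_apply hφ hB, key, key,
    Measure.map_apply e.symm.measurable (hφ hB), Measure.map_apply e.symm.measurable (hφ hB),
    withDensity_comp_norm_cone_eq m hA hcone, withDensity_comp_norm_cone_eq m hA hcone]

/-- The `p`-generalized Gaussian distribution, with density proportional to `exp (-|x|^p / p)`. -/
noncomputable def pGaussian (p : ℝ) : Measure ℝ :=
  volume.withDensity fun y =>
    ENNReal.ofReal ((2 * p ^ (1 / p) * Real.Gamma (1 + 1 / p))⁻¹ * Real.exp (-|y| ^ p / p))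

section pGaussian

variable {p : ℝ}

theorem pGaussian_const_pos (hp : 1 ≤ p) :
    0 < (2 * p ^ (1 / p) * Real.Gamma (1 + 1 / p))⁻¹ := by
  have hp0 : 0 < p := by linarith
  have := Real.Gamma_pos_of_pos (show 0 < 1 + 1 / p by positivity)
  positivity

theorem measurable_pGaussian_density (c p : ℝ) :
    Measurable fun y : ℝ => c * Real.exp (-|y| ^ p / p) := by
  fun_prop

theorem integral_abs_rpow_mul_exp (hp : 1 ≤ p) {s : ℝ} (hs : 0 ≤ s) :
    ∫ y : ℝ, |y| ^ s * Real.exp (-|y| ^ p / p) =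
      2 * (p ^ ((s + 1) / p) * (1 / p) * Real.Gamma ((s + 1) / p)) := by
  have hp0 : 0 < p := by linarith
  rw [integral_comp_abs (f := fun x => x ^ s * Real.exp (-x ^ p / p))]
  have h := integral_rpow_mul_exp_neg_mul_rpow (q := s) hp0 (by linarith) (inv_pos.2 hp0)
  rw [Real.inv_rpow hp0.le, ← Real.rpow_neg hp0.le] at h
  rw [show -(-(s + 1) / p) = (s + 1) / p by ring] at h
  rw [← h]
  congr 2
  ext x
  ring_nf

theorem integrable_abs_rpow_mul_exp (hp : 1 ≤ p) {s : ℝ} (hs : 0 ≤ s) :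
    Integrable fun y : ℝ => |y| ^ s * Real.exp (-|y| ^ p / p) := by
  have hp0 : 0 < p := by linarith
  have hG := Real.Gamma_pos_of_pos (show 0 < (s + 1) / p by positivity)
  refine Integrable.of_integral_ne_zero ?_
  rw [integral_abs_rpow_mul_exp hp hs]
  positivity

theorem integrable_pGaussian_abs_rpow (hp : 1 ≤ p) {s : ℝ} (hs : 0 ≤ s) :
    Integrable (fun y : ℝ => |y| ^ s) (pGaussian p) := by
  rw [pGaussian, integrable_withDensity_iff_integrable_smul'
    (measurable_pGaussian_density _ p).ennreal_ofReal (by simp)]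
  refine ((integrable_abs_rpow_mul_exp hp hs).const_mul
    (2 * p ^ (1 / p) * Real.Gamma (1 + 1 / p))⁻¹).congr (ae_of_all _ fun y => ?_)
  simp only
  rw [ENNReal.toReal_ofReal (by have := pGaussian_const_pos hp; positivity), smul_eq_mul]
  ring

theorem integral_pGaussian_abs_rpow (hp : 1 ≤ p) {s : ℝ} (hs : 0 ≤ s) :
    ∫ y, |y| ^ s ∂(pGaussian p) =
      p ^ (s / p) * Real.Gamma ((s + 1) / p) / Real.Gamma (1 / p) := by
  have hp0 : 0 < p := by linarith
  have hG := Real.Gamma_pos_of_pos (show 0 < 1 / p by positivity)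
  rw [pGaussian, integral_withDensity_eq_integral_toReal_smul
    (measurable_pGaussian_density _ p).ennreal_ofReal (by simp)]
  have h (y : ℝ) : (ENNReal.ofReal ((2 * p ^ (1 / p) * Real.Gamma (1 + 1 / p))⁻¹ *
      Real.exp (-|y| ^ p / p))).toReal • |y| ^ s =
      (2 * p ^ (1 / p) * Real.Gamma (1 + 1 / p))⁻¹ * (|y| ^ s * Real.exp (-|y| ^ p / p)) := by
    rw [ENNReal.toReal_ofReal (by have := pGaussian_const_pos hp; positivity), smul_eq_mul]
    ring
  simp_rw [h]
  rw [integral_const_mul, integral_abs_rpow_mul_exp hp hs, add_comm 1 (1 / p),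
    Real.Gamma_add_one (by positivity), add_div, Real.rpow_add hp0]
  have : 0 < p ^ (1 / p) := by positivity
  field_simp

theorem isProbabilityMeasure_pGaussian (hp : 1 ≤ p) : IsProbabilityMeasure (pGaussian p) := by
  have hp0 : 0 < p := by linarith
  have hG := Real.Gamma_pos_of_pos (show 0 < 1 / p by positivity)
  have h := integral_pGaussian_abs_rpow hp le_rfl
  simp only [Real.rpow_zero, zero_div, zero_add, one_mul, div_self hG.ne', integral_const,
    smul_eq_mul, mul_one] at h
  refine ⟨?_⟩
  rw [measureReal_def] at h
  exact (ENNReal.toReal_eq_one_iff _).1 h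

theorem pi_withDensity_ofReal {ι : Type*} [Fintype ι] {f : ℝ → ℝ} (hf : Integrable f)
    (hf0 : ∀ x, 0 ≤ f x) :
    Measure.pi (fun _ : ι => (volume : Measure ℝ).withDensity fun x => ENNReal.ofReal (f x)) =
      volume.withDensity fun x : ι → ℝ => ENNReal.ofReal (∏ i, f (x i)) := by
  have : IsFiniteMeasure ((volume : Measure ℝ).withDensity fun x => ENNReal.ofReal (f x)) :=
    isFiniteMeasure_withDensity_ofReal hf.2
  refine Measure.pi_eq fun s hs => ?_
  rw [withDensity_apply _ (MeasurableSet.univ_pi hs), volume_pi, Measure.restrict_pi_pi,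
    ← ofReal_integral_eq_lintegral_ofReal, integral_fintype_prod_eq_prod,
    ENNReal.ofReal_prod_of_nonneg]
  · refine Finset.prod_congr rfl fun i _ => ?_
    rw [withDensity_apply _ (hs i), ← ofReal_integral_eq_lintegral_ofReal hf.integrableOn]
    exact ae_of_all _ hf0
  · exact fun i _ => integral_nonneg hf0
  · exact Integrable.fintype_prod fun i => hf.integrableOn
  · exact ae_of_all _ fun x => Finset.prod_nonneg fun i _ => hf0 _

theorem pnorm_rpow {n : ℕ} (hp : 1 ≤ p) (x : Fin n → ℝ) :
    pnorm p x ^ p = ∑ i, |x i| ^ p := by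
  rw [pnorm, ← Real.rpow_mul (Finset.sum_nonneg fun i _ => by positivity),
    one_div_mul_cancel (by linarith), Real.rpow_one]

/-- The vector of independent `p`-generalized Gaussians is `p`-radial. -/
theorem pi_pGaussian_eq_withDensity (hp : 1 ≤ p) (n : ℕ) :
    Measure.pi (fun _ : Fin n => pGaussian p) =
      volume.withDensity fun x : Fin n → ℝ =>
        (fun r : ℝ => ENNReal.ofReal ((2 * p ^ (1 / p) * Real.Gamma (1 + 1 / p))⁻¹ ^ n *
          Real.exp (-r ^ p / p))) (pnorm p x) := by
  have hc := pGaussian_const_pos hp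
  unfold pGaussian
  rw [pi_withDensity_ofReal]
  · congr 1
    ext x
    simp only
    rw [pnorm_rpow hp, Finset.prod_mul_distrib, ← Real.exp_sum, Finset.prod_const,
      Finset.card_univ, Fintype.card_fin, ← Finset.sum_div, Finset.sum_neg_distrib]
  · simpa using (integrable_abs_rpow_mul_exp hp le_rfl).const_mul _
  · intro x
    positivity

theorem Mp_eq (hp : 1 ≤ p) {q : ℝ} (hq : 0 ≤ q) :
    Mp p q = p ^ (q / p) * Real.Gamma ((q + 1) / p) / Real.Gamma (1 / p) := by
  have hp0 : 0 < p := by linarith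
  have hG := Real.Gamma_pos_of_pos (show 0 < 1 / p by positivity)
  rw [Mp, add_comm 1 ((q + 1) / p), add_comm 1 (1 / p),
    Real.Gamma_add_one (by positivity), Real.Gamma_add_one (by positivity)]
  field_simp

theorem Mp_pos (hp : 1 ≤ p) {q : ℝ} (hq : 0 ≤ q) : 0 < Mp p q := by
  have hp0 : 0 < p := by linarith
  have h1 := Real.Gamma_pos_of_pos (show 0 < 1 / p by positivity)
  have h2 := Real.Gamma_pos_of_pos (show 0 < (q + 1) / p by positivity)
  rw [Mp_eq hp hq]
  positivity

theorem integral_pGaussian_eq_Mp (hp : 1 ≤ p) {q : ℝ} (hq : 0 ≤ q) :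
    ∫ y, |y| ^ q ∂(pGaussian p) = Mp p q := by
  rw [integral_pGaussian_abs_rpow hp hq, Mp_eq hp hq]

theorem Mp_add_self (hp : 1 ≤ p) {q : ℝ} (hq : 0 ≤ q) :
    Mp p (q + p) = (q + 1) * Mp p q := by
  have hp0 : 0 < p := by linarith
  rw [Mp_eq hp hq, Mp_eq hp (by linarith), show (q + p + 1) / p = (q + 1) / p + 1 by field_simp; ring,
    Real.Gamma_add_one (by positivity), add_div q p p, div_self hp0.ne', Real.rpow_add hp0,
    Real.rpow_one]
  field_simp

theorem Mp_zero (hp : 1 ≤ p) : Mp p 0 = 1 := by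
  have hp0 : 0 < p := by linarith
  have h1 := Real.Gamma_pos_of_pos (show 0 < 1 / p by positivity)
  rw [Mp_eq hp le_rfl, zero_div, Real.rpow_zero, zero_add, one_mul, div_self h1.ne']

theorem Mp_self (hp : 1 ≤ p) : Mp p p = 1 := by
  simpa [Mp_zero hp] using Mp_add_self hp le_rfl

theorem covEntry_eq (hp : 1 ≤ p) {a b : ℝ} (ha : 0 ≤ a) (hb : 0 ≤ b) :
    covEntry p a b = 1 / (a * b) * (Mp p (a + b) / (Mp p a * Mp p b) - 1) - 1 / p := by
  have hp0 : 0 < p := by linarith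
  have h1 := Real.Gamma_pos_of_pos (show 0 < 1 / p by positivity)
  have h2 := Real.Gamma_pos_of_pos (show 0 < (a + 1) / p by positivity)
  have h3 := Real.Gamma_pos_of_pos (show 0 < (b + 1) / p by positivity)
  rw [covEntry, Mp_eq hp ha, Mp_eq hp hb, Mp_eq hp (add_nonneg ha hb), add_div a b p,
    Real.rpow_add hp0]
  have : 0 < p ^ (a / p) := by positivity
  have : 0 < p ^ (b / p) := by positivity
  congr 3
  field_simp

end pGaussian

section InMeasure

variable {Ω : ℕ → Type*} {m : ∀ n, MeasurableSpace (Ω n)}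

/-- Convergence to zero in probability, for random variables defined on varying spaces. -/
def VanishesInMeasure (P : ∀ n, Measure (Ω n)) (D : ∀ n, Ω n → ℝ) : Prop :=
  ∀ ε : ℝ, 0 < ε → Tendsto (fun n => P n {ω | ε ≤ |D n ω|}) atTop (𝓝 0)

/-- Asymptotic tightness, for random variables defined on varying spaces. -/
def BoundedInMeasure (P : ∀ n, Measure (Ω n)) (A : ∀ n, Ω n → ℝ) : Prop :=
  ∀ δ : ℝ≥0∞, 0 < δ → ∃ K : ℝ, ∀ᶠ n in atTop, P n {ω | K ≤ |A n ω|} ≤ δ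

variable {P : ∀ n, Measure (Ω n)}

theorem VanishesInMeasure.add {D E : ∀ n, Ω n → ℝ} (hD : VanishesInMeasure P D)
    (hE : VanishesInMeasure P E) : VanishesInMeasure P fun n ω => D n ω + E n ω := by
  intro ε hε
  have h := (hD (ε / 2) (by positivity)).add (hE (ε / 2) (by positivity))
  rw [add_zero] at h
  refine tendsto_of_tendsto_of_tendsto_of_le_of_le tendsto_const_nhds h (fun _ => zero_le)
    fun n => (measure_mono fun ω hω => ?_).trans (measure_union_le _ _)
  simp only [mem_ofPred_eq, mem_union] at hω ⊢
  by_contra! hlt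
  linarith [abs_add_le (D n ω) (E n ω)]

theorem VanishesInMeasure.const_mul {D : ∀ n, Ω n → ℝ} (hD : VanishesInMeasure P D) (c : ℝ) :
    VanishesInMeasure P fun n ω => c * D n ω := by
  intro ε hε
  refine tendsto_of_tendsto_of_tendsto_of_le_of_le tendsto_const_nhds
    (hD (ε / (|c| + 1)) (by positivity)) (fun _ => zero_le)
    fun n => measure_mono fun ω hω => ?_
  simp only [mem_ofPred_eq, abs_mul] at hω ⊢
  rw [div_le_iff₀ (by positivity)]
  nlinarith [abs_nonneg (D n ω)]

theorem VanishesInMeasure.sum {ι : Type*} {D : ι → ∀ n, Ω n → ℝ} (s : Finset ι)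
    (hD : ∀ i ∈ s, VanishesInMeasure P (D i)) :
    VanishesInMeasure P fun n ω => ∑ i ∈ s, D i n ω := by
  classical
  induction s using Finset.induction_on with
  | empty =>
    intro ε hε
    simp [hε.not_ge]
  | insert i s hi ih =>
    simp only [Finset.sum_insert hi]
    exact (hD i (by simp)).add (ih fun j hj => hD j (by simp [hj]))

theorem VanishesInMeasure.congr {D E : ∀ n, Ω n → ℝ} (hD : VanishesInMeasure P D)
    (h : ∀ᶠ n in atTop, ∀ ω, D n ω = E n ω) : VanishesInMeasure P E := by
  intro ε hε
  refine (hD ε hε).congr' ?_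
  filter_upwards [h] with n hn
  simp [hn]

theorem BoundedInMeasure.congr {A B : ∀ n, Ω n → ℝ} (hA : BoundedInMeasure P A)
    (h : ∀ᶠ n in atTop, ∀ ω, A n ω = B n ω) : BoundedInMeasure P B := by
  intro δ hδ
  obtain ⟨K, hK⟩ := hA δ hδ
  refine ⟨K, ?_⟩
  filter_upwards [hK, h] with n h₁ h₂
  simpa only [h₂] using h₁

theorem BoundedInMeasure.of_map_eq {Ω' : ℕ → Type*} {m' : ∀ n, MeasurableSpace (Ω' n)}
    {P' : ∀ n, Measure (Ω' n)} {A : ∀ n, Ω n → ℝ} {A' : ∀ n, Ω' n → ℝ}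
    (h : BoundedInMeasure P A) (hA : ∀ n, AEMeasurable (A n) (P n))
    (hA' : ∀ n, AEMeasurable (A' n) (P' n))
    (hmap : ∀ᶠ n in atTop, (P' n).map (A' n) = (P n).map (A n)) : BoundedInMeasure P' A' := by
  intro δ hδ
  obtain ⟨K, hK⟩ := h δ hδ
  refine ⟨K, ?_⟩
  filter_upwards [hK, hmap] with n h₁ h₂
  have hS : MeasurableSet {y : ℝ | K ≤ |y|} := measurableSet_le measurable_const measurable_id.abs
  have h₃ := congrArg (fun ν : Measure ℝ => ν {y | K ≤ |y|}) h₂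
  simp only [Measure.map_apply_of_aemeasurable (hA n) hS,
    Measure.map_apply_of_aemeasurable (hA' n) hS] at h₃
  exact h₃.trans_le h₁

theorem BoundedInMeasure.mul_vanishes {A D : ∀ n, Ω n → ℝ} (hA : BoundedInMeasure P A)
    (hD : VanishesInMeasure P D) : VanishesInMeasure P fun n ω => A n ω * D n ω := by
  intro ε hε
  rw [ENNReal.tendsto_nhds_zero]
  intro δ hδ
  have hδ' := ENNReal.half_pos hδ.ne'
  obtain ⟨K, hK⟩ := hA _ hδ'
  filter_upwards [hK, ENNReal.tendsto_nhds_zero.1 (hD (ε / (|K| + 1)) (by positivity)) _ hδ']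
    with n h₁ h₂
  rw [← ENNReal.add_halves δ]
  refine ((measure_mono fun ω hω => ?_).trans (measure_union_le _ _)).trans (add_le_add h₁ h₂)
  simp only [mem_ofPred_eq, mem_union, abs_mul] at hω ⊢
  by_contra! hlt
  rw [lt_div_iff₀ (by positivity)] at hlt
  nlinarith [abs_nonneg (D n ω), le_abs_self K]

theorem BoundedInMeasure.const_mul {A : ∀ n, Ω n → ℝ} (hA : BoundedInMeasure P A) (c : ℝ) :
    BoundedInMeasure P fun n ω => c * A n ω := by
  intro δ hδ
  obtain ⟨K, hK⟩ := hA δ hδ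
  refine ⟨(|c| + 1) * (|K| + 1), ?_⟩
  filter_upwards [hK] with n hn
  refine (measure_mono fun ω hω => ?_).trans hn
  simp only [mem_ofPred_eq, abs_mul] at hω ⊢
  by_contra! hlt
  have h₁ := le_abs_self K
  nlinarith [abs_nonneg c, abs_nonneg (A n ω), mul_nonneg (abs_nonneg c) (sub_nonneg.2
    (hlt.le.trans h₁)), abs_nonneg K]

theorem BoundedInMeasure.sup {A B : ∀ n, Ω n → ℝ} (hA : BoundedInMeasure P A)
    (hB : BoundedInMeasure P B) : BoundedInMeasure P fun n ω => max |A n ω| |B n ω| := by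
  intro δ hδ
  have hδ' := ENNReal.half_pos hδ.ne'
  obtain ⟨K, hK⟩ := hA _ hδ'
  obtain ⟨L, hL⟩ := hB _ hδ'
  refine ⟨max K L, ?_⟩
  filter_upwards [hK, hL] with n h₁ h₂
  rw [← ENNReal.add_halves δ]
  refine ((measure_mono fun ω hω => ?_).trans (measure_union_le _ _)).trans (add_le_add h₁ h₂)
  simp only [mem_ofPred_eq, mem_union] at hω ⊢
  rw [abs_of_nonneg (le_max_of_le_left (abs_nonneg _)), max_le_iff] at hω
  rcases le_total |A n ω| |B n ω| with h | h
  · exact Or.inr (max_eq_right h ▸ hω.2)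
  · exact Or.inl (max_eq_left h ▸ hω.1)


/-- Small perturbations at scale `1 / √n` stay in any neighbourhood with high probability. -/
theorem BoundedInMeasure.eventually_measure_le {E : Type*} [SeminormedAddCommGroup E]
    {v : ∀ n, Ω n → E} (hv : BoundedInMeasure P fun n ω => Real.sqrt n * ‖v n ω‖)
    {δ : ℝ≥0∞} (hδ : 0 < δ) : ∃ K > 0, ∀ r > 0, ∀ᶠ n : ℕ in atTop,
      P n {ω | K ≤ Real.sqrt n * ‖v n ω‖ ∨ r ≤ ‖v n ω‖} ≤ δ := by
  obtain ⟨K, hK⟩ := hv δ hδ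
  refine ⟨max K 1, by positivity, fun r hr => ?_⟩
  have hlim : Tendsto (fun n : ℕ => Real.sqrt n * r) atTop atTop :=
    (Real.tendsto_sqrt_atTop.comp tendsto_natCast_atTop_atTop).atTop_mul_const hr
  filter_upwards [hK, hlim.eventually_ge_atTop (max K 1)] with n h₁ h₂
  refine (measure_mono fun ω hω => ?_).trans h₁
  have h₃ : max K 1 ≤ Real.sqrt n * ‖v n ω‖ := by
    rcases hω with h | h
    · exact h
    · exact h₂.trans (by gcongr)
  exact (le_max_left _ _).trans (h₃.trans (le_abs_self _))

theorem BoundedInMeasure.comp_continuousAt {E : Type*} [SeminormedAddCommGroup E]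
    {v : ∀ n, Ω n → E} (hv : BoundedInMeasure P fun n ω => Real.sqrt n * ‖v n ω‖)
    {f : E → ℝ} (hf : ContinuousAt f 0) : BoundedInMeasure P fun n ω => f (v n ω) := by
  intro δ hδ
  obtain ⟨K, -, hK⟩ := hv.eventually_measure_le hδ
  obtain ⟨r, hr, hball⟩ := Metric.continuousAt_iff.1 hf 1 one_pos
  refine ⟨|f 0| + 1, (hK r hr).mono fun n hn => (measure_mono fun ω hω => ?_).trans hn⟩
  simp only [mem_ofPred_eq] at hω ⊢
  by_contra! hlt
  have h := hball (x := v n ω) (by simpa using hlt.2)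
  rw [Real.dist_eq] at h
  linarith [abs_sub_abs_le_abs_sub (f (v n ω)) (f 0)]

/-- The delta method. -/
theorem BoundedInMeasure.vanishes_of_hasFDerivAt {E : Type*} [NormedAddCommGroup E]
    [NormedSpace ℝ E] {v : ∀ n, Ω n → E}
    (hv : BoundedInMeasure P fun n ω => Real.sqrt n * ‖v n ω‖)
    {f : E → ℝ} {f' : E →L[ℝ] ℝ} (hf : HasFDerivAt f f' 0) :
    VanishesInMeasure P fun n ω => Real.sqrt n * (f (v n ω) - f 0 - f' (v n ω)) := by
  intro ε hε
  rw [ENNReal.tendsto_nhds_zero]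
  intro δ hδ
  obtain ⟨K, hK0, hK⟩ := hv.eventually_measure_le hδ
  have hO := hf.isLittleO.def (c := ε / K) (by positivity)
  obtain ⟨r, hr, hball⟩ := Metric.eventually_nhds_iff.1 hO
  refine (hK r hr).mono fun n hn => (measure_mono fun ω hω => ?_).trans hn
  simp only [mem_ofPred_eq] at hω ⊢
  by_contra! hlt
  have h := hball (y := v n ω) (by simpa using hlt.2)
  simp only [sub_zero, Real.norm_eq_abs] at h
  rw [abs_mul, abs_of_nonneg (Real.sqrt_nonneg _)] at hω
  have h₂ : Real.sqrt n * |f (v n ω) - f 0 - f' (v n ω)| ≤ ε / K * (Real.sqrt n * ‖v n ω‖) := by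
    calc _ ≤ Real.sqrt n * (ε / K * ‖v n ω‖) := by gcongr
      _ = _ := by ring
  have h₃ : ε / K * (Real.sqrt n * ‖v n ω‖) < ε / K * K := by
    have := hlt.1
    gcongr
  rw [div_mul_cancel₀ _ hK0.ne'] at h₃
  linarith

theorem VanishesInMeasure.tendsto_integral_cexp_sub [∀ n, IsProbabilityMeasure (P n)]
    {A B : ∀ n, Ω n → ℝ} (hA : ∀ n, Measurable (A n)) (hB : ∀ n, Measurable (B n))
    (h : VanishesInMeasure P fun n ω => A n ω - B n ω) :
    Tendsto (fun n => ∫ ω, Complex.exp (A n ω * Complex.I) ∂P n -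
      ∫ ω, Complex.exp (B n ω * Complex.I) ∂P n) atTop (𝓝 0) := by
  have hint : ∀ {n} {C : Ω n → ℝ}, Measurable C →
      Integrable (fun ω => Complex.exp (C ω * Complex.I)) (P n) := fun hC =>
    Integrable.of_bound (by fun_prop) 1 (by simp [Complex.norm_exp_ofReal_mul_I])
  rw [Metric.tendsto_atTop']
  intro ε hε
  have h₁ : Tendsto (fun n => (P n).real {ω | ε / 4 ≤ |A n ω - B n ω|}) atTop (𝓝 0) :=
    (ENNReal.tendsto_toReal ENNReal.zero_ne_top).comp (h (ε / 4) (by positivity))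
  obtain ⟨n₀, hn₀⟩ := Filter.eventually_atTop.1
    (h₁.eventually_lt_const (show (0 : ℝ) < ε / 4 by positivity))
  refine ⟨n₀, fun n hn => ?_⟩
  have hS : MeasurableSet {ω | ε / 4 ≤ |A n ω - B n ω|} :=
    measurableSet_le measurable_const ((hA n).sub (hB n)).abs
  rw [dist_zero_right, ← integral_sub (hint (hA n)) (hint (hB n))]
  have hbound : ∀ ω, ‖Complex.exp (A n ω * Complex.I) - Complex.exp (B n ω * Complex.I)‖ ≤
      ε / 4 + {ω | ε / 4 ≤ |A n ω - B n ω|}.indicator (fun _ => (2 : ℝ)) ω := by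
    intro ω
    by_cases hω : ω ∈ {ω | ε / 4 ≤ |A n ω - B n ω|}
    · rw [indicator_of_mem hω]
      refine (norm_sub_le _ _).trans ?_
      rw [Complex.norm_exp_ofReal_mul_I, Complex.norm_exp_ofReal_mul_I]
      linarith
    · rw [indicator_of_notMem hω, add_zero]
      have heq : Complex.exp (A n ω * Complex.I) - Complex.exp (B n ω * Complex.I) =
          Complex.exp (B n ω * Complex.I) *
            (Complex.exp (Complex.I * ((A n ω - B n ω : ℝ) : ℂ)) - 1) := by
        rw [mul_sub, ← Complex.exp_add, mul_one]
        push_cast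
        ring_nf
      rw [heq, norm_mul, Complex.norm_exp_ofReal_mul_I, one_mul]
      exact (Real.norm_exp_I_mul_ofReal_sub_one_le).trans (not_le.1 hω).le
  calc _ ≤ ∫ ω, (ε / 4 + {ω | ε / 4 ≤ |A n ω - B n ω|}.indicator (fun _ => (2 : ℝ)) ω) ∂P n :=
        norm_integral_le_of_norm_le
          ((integrable_const _).add ((integrable_const _).indicator hS)) (ae_of_all _ hbound)
    _ = ε / 4 + (P n).real {ω | ε / 4 ≤ |A n ω - B n ω|} * 2 := by
        rw [integral_add (integrable_const _) ((integrable_const _).indicator hS),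
          integral_indicator_const _ hS]
        simp
    _ < ε := by linarith [hn₀ n hn.le]

end InMeasure

theorem boundedInMeasure_inv_sqrt_mul_sum {Ω : Type*} {m : MeasurableSpace Ω} {P : Measure Ω}
    [IsProbabilityMeasure P] {X : ℕ → Ω → ℝ} (hX : MemLp (X 0) 2 P) (hmean : ∫ ω, X 0 ω ∂P = 0)
    (hindep : ProbabilityTheory.iIndepFun X P)
    (hident : ∀ j, ProbabilityTheory.IdentDistrib (X j) (X 0) P P) :
    BoundedInMeasure (fun _ => P)
      fun n ω => (Real.sqrt n)⁻¹ * ∑ j ∈ Finset.range n, X j ω := by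
  have hL2 : ∀ j, MemLp (X j) 2 P := fun j => (hident j).memLp_iff.2 hX
  have hcheb : ∀ n : ℕ, 0 < n → ∀ K : ℝ, 0 < K →
      P {ω | K ≤ |(Real.sqrt n)⁻¹ * ∑ j ∈ Finset.range n, X j ω|} ≤
        ENNReal.ofReal (ProbabilityTheory.variance (X 0) P / K ^ 2) := by
    intro n hn K hK
    have hmem : MemLp (fun ω => (Real.sqrt n)⁻¹ * ∑ j ∈ Finset.range n, X j ω) 2 P :=
      (memLp_finsetSum _ fun j _ => hL2 j).const_mul _
    have hint : ∫ ω, (Real.sqrt n)⁻¹ * ∑ j ∈ Finset.range n, X j ω ∂P = 0 := by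
      rw [integral_const_mul, integral_finsetSum _ fun j _ => (hL2 j).integrable one_le_two]
      simp [fun j => (hident j).integral_eq, hmean]
    have hvar : ProbabilityTheory.variance
        (fun ω => (Real.sqrt n)⁻¹ * ∑ j ∈ Finset.range n, X j ω) P =
          ProbabilityTheory.variance (X 0) P := by
      rw [ProbabilityTheory.variance_const_mul]
      have := ProbabilityTheory.IndepFun.variance_sum (X := X) (s := Finset.range n)
        (fun j _ => hL2 j) fun i _ j _ hij => hindep.indepFun hij
      rw [show (fun ω => ∑ j ∈ Finset.range n, X j ω) = ∑ j ∈ Finset.range n, X j by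
        ext; simp, this]
      simp only [fun j => (hident j).variance_eq, Finset.sum_const, Finset.card_range, nsmul_eq_mul]
      rw [inv_pow, Real.sq_sqrt (by positivity)]
      field_simp
    have := ProbabilityTheory.meas_ge_le_variance_div_sq hmem hK
    rwa [hint, hvar, show {ω | K ≤ |(Real.sqrt n)⁻¹ * ∑ j ∈ Finset.range n, X j ω - 0|} =
      {ω | K ≤ |(Real.sqrt n)⁻¹ * ∑ j ∈ Finset.range n, X j ω|} by simp] at this
  intro δ hδ
  have hlim : Tendsto (fun K : ℝ => ENNReal.ofReal
      (ProbabilityTheory.variance (X 0) P / K ^ 2)) atTop (𝓝 0) := by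
    rw [← ENNReal.ofReal_zero]
    exact ENNReal.tendsto_ofReal (tendsto_const_nhds.div_atTop (tendsto_pow_atTop two_ne_zero))
  obtain ⟨K, hK, hKδ⟩ := ((eventually_gt_atTop 0).and
    (ENNReal.tendsto_nhds_zero.1 hlim δ hδ)).exists
  exact ⟨K, (eventually_gt_atTop 0).mono fun n hn => (hcheb n hn K hK).trans hKδ⟩

/-- The `q`-th absolute power, normalized to be centred under `pGaussian p`. -/
noncomputable def centredPow (p q y : ℝ) : ℝ := |y| ^ q / Mp p q - 1

/-- The first-order contribution of a coordinate to the ratio of the `q`- and `p`-norms. -/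
noncomputable def normScore (p q y : ℝ) : ℝ := centredPow p q y / q - centredPow p p y / p

/-- The ratio of the `q`- and `p`-norms, normalized to tend to `1`. -/
noncomputable def normRatio (p q : ℝ) {n : ℕ} (x : Fin n → ℝ) : ℝ :=
  (n : ℝ) ^ (1 / p - 1 / q) * pnorm q x / mpq p q / pnorm p x

section NormRatio

variable {p a b q : ℝ}

theorem measurable_centredPow : Measurable (centredPow p q) :=
  (((measurable_id.abs).pow_const q).div_const _).sub_const 1

theorem measurable_normScore : Measurable (normScore p q) :=
  (measurable_centredPow.div_const _).sub (measurable_centredPow.div_const _)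

theorem measurable_pnorm {n : ℕ} : Measurable (pnorm q : (Fin n → ℝ) → ℝ) := by
  unfold pnorm
  fun_prop

theorem measurable_normRatio {n : ℕ} : Measurable (normRatio p q : (Fin n → ℝ) → ℝ) :=
  ((measurable_pnorm.const_mul _).div_const _).div measurable_pnorm

theorem memLp_centredPow (hp : 1 ≤ p) (ha : 0 ≤ a) : MemLp (centredPow p a) 2 (pGaussian p) := by
  have := isProbabilityMeasure_pGaussian hp
  refine MemLp.sub (g := fun _ => (1 : ℝ)) ?_ (memLp_const 1)
  have h : MemLp (fun y : ℝ => |y| ^ a) 2 (pGaussian p) := by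
    rw [memLp_two_iff_integrable_sq (by fun_prop)]
    refine (integrable_pGaussian_abs_rpow hp (s := a + a) (by positivity)).congr
      (ae_of_all _ fun y => ?_)
    simp only [Real.rpow_add_of_nonneg (abs_nonneg y) ha ha, sq]
  simpa only [div_eq_mul_inv] using h.mul_const _

theorem memLp_normScore (hp : 1 ≤ p) (hq : 0 ≤ q) : MemLp (normScore p q) 2 (pGaussian p) := by
  unfold normScore
  simp only [div_eq_mul_inv]
  exact ((memLp_centredPow hp hq).mul_const _).sub
    ((memLp_centredPow hp (zero_le_one.trans hp)).mul_const _)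

theorem integral_centredPow (hp : 1 ≤ p) (ha : 0 ≤ a) :
    ∫ y, centredPow p a y ∂pGaussian p = 0 := by
  have := isProbabilityMeasure_pGaussian hp
  unfold centredPow
  rw [integral_sub ((integrable_pGaussian_abs_rpow hp ha).div_const _) (integrable_const _),
    integral_div, integral_pGaussian_eq_Mp hp ha, div_self (Mp_pos hp ha).ne']
  simp

theorem integral_normScore (hp : 1 ≤ p) (hq : 0 ≤ q) :
    ∫ y, normScore p q y ∂pGaussian p = 0 := by
  have := isProbabilityMeasure_pGaussian hp
  have hp0 : 0 ≤ p := zero_le_one.trans hp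
  unfold normScore
  rw [integral_sub (((memLp_centredPow hp hq).integrable one_le_two).div_const _)
    (((memLp_centredPow hp hp0).integrable one_le_two).div_const _), integral_div, integral_div,
    integral_centredPow hp hq, integral_centredPow hp hp0]
  simp

theorem integral_centredPow_mul (hp : 1 ≤ p) (ha : 0 ≤ a) (hb : 0 ≤ b) :
    ∫ y, centredPow p a y * centredPow p b y ∂pGaussian p =
      Mp p (a + b) / (Mp p a * Mp p b) - 1 := by
  have := isProbabilityMeasure_pGaussian hp
  have hab := integrable_pGaussian_abs_rpow hp (s := a + b) (by positivity)
  have hexp : ∀ y, centredPow p a y * centredPow p b y =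
      |y| ^ (a + b) / (Mp p a * Mp p b) - centredPow p a y - centredPow p b y - 1 := by
    intro y
    have h₁ := (Mp_pos hp ha).ne'
    have h₂ := (Mp_pos hp hb).ne'
    rw [Real.rpow_add_of_nonneg (abs_nonneg y) ha hb]
    unfold centredPow
    field_simp
    ring
  have ia := (memLp_centredPow hp ha).integrable one_le_two
  have ib := (memLp_centredPow hp hb).integrable one_le_two
  simp only [hexp]
  rw [integral_sub (((hab.div_const _).sub' ia).sub' ib) (integrable_const _),
    integral_sub ((hab.div_const _).sub' ia) ib, integral_sub (hab.div_const _) ia, integral_div,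
    integral_pGaussian_eq_Mp hp (by positivity), integral_centredPow hp ha,
    integral_centredPow hp hb]
  simp

theorem integral_normScore_mul (hp : 1 ≤ p) (ha : 0 < a) (hb : 0 < b) :
    ∫ y, normScore p a y * normScore p b y ∂pGaussian p = covEntry p a b := by
  have hp0 : 0 < p := zero_lt_one.trans_le hp
  have hmul : ∀ {s t : ℝ}, 0 ≤ s → 0 ≤ t → ∀ c : ℝ,
      Integrable (fun y => centredPow p s y * centredPow p t y / c) (pGaussian p) :=
    fun hs ht c => ((memLp_centredPow hp hs).integrable_mul (memLp_centredPow hp ht)).div_const c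
  have hexp : ∀ y, normScore p a y * normScore p b y =
      centredPow p a y * centredPow p b y / (a * b) - centredPow p a y * centredPow p p y / (a * p)
        - centredPow p b y * centredPow p p y / (b * p)
        + centredPow p p y * centredPow p p y / (p * p) := by
    intro y
    unfold normScore
    field_simp
    ring
  simp only [hexp]
  rw [integral_add (((hmul ha.le hb.le _).sub' (hmul ha.le hp0.le _)).sub' (hmul hb.le hp0.le _))
      (hmul hp0.le hp0.le _),
    integral_sub ((hmul ha.le hb.le _).sub' (hmul ha.le hp0.le _)) (hmul hb.le hp0.le _),
    integral_sub (hmul ha.le hb.le _) (hmul ha.le hp0.le _)]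
  simp only [integral_div]
  rw [integral_centredPow_mul hp ha.le hb.le, integral_centredPow_mul hp ha.le hp0.le,
    integral_centredPow_mul hp hb.le hp0.le, integral_centredPow_mul hp hp0.le hp0.le,
    covEntry_eq hp ha.le hb.le, Mp_add_self hp ha.le, Mp_add_self hp hb.le,
    Mp_add_self hp hp0.le, Mp_self hp]
  have h₁ := (Mp_pos hp ha.le).ne'
  have h₂ := (Mp_pos hp hb.le).ne'
  field_simp
  ring

theorem variance_sum_normScore (hp : 1 ≤ p) {ι : Type*} [Fintype ι] {q : ι → ℝ}
    (hq : ∀ i, 0 < q i) (u : ι → ℝ) :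
    ProbabilityTheory.variance (fun y => ∑ i, u i * normScore p (q i) y) (pGaussian p) =
      ∑ i, ∑ j, u i * covEntry p (q i) (q j) * u j := by
  have := isProbabilityMeasure_pGaussian hp
  have hmem := fun i => memLp_normScore hp (hq i).le
  have hmean : ∫ y, ∑ i, u i * normScore p (q i) y ∂pGaussian p = 0 := by
    rw [integral_finsetSum _ fun i _ => ((hmem i).integrable one_le_two).const_mul _]
    simp [integral_const_mul, fun i => integral_normScore hp (hq i).le]
  rw [ProbabilityTheory.variance_of_integral_eq_zero
    (Finset.aemeasurable_fun_sum _ fun i _ => (measurable_normScore.const_mul _).aemeasurable)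
    hmean]
  have hexp : ∀ y, (∑ i, u i * normScore p (q i) y) ^ 2 =
      ∑ i, ∑ j, u i * u j * (normScore p (q i) y * normScore p (q j) y) := by
    intro y
    rw [sq, Finset.sum_mul_sum]
    refine Finset.sum_congr rfl fun i _ => Finset.sum_congr rfl fun j _ => ?_
    ring
  have hint : ∀ i j, Integrable
      (fun y => u i * u j * (normScore p (q i) y * normScore p (q j) y)) (pGaussian p) :=
    fun i j => ((hmem i).integrable_mul (hmem j)).const_mul _
  simp only [hexp]
  rw [integral_finsetSum _ fun i _ => integrable_finsetSum _ fun j _ => hint i j]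
  refine Finset.sum_congr rfl fun i _ => ?_
  rw [integral_finsetSum _ fun j _ => hint i j]
  refine Finset.sum_congr rfl fun j _ => ?_
  rw [integral_const_mul, integral_normScore_mul hp (hq i) (hq j)]
  ring

theorem hasFDerivAt_ratio_rpow (p q : ℝ) :
    HasFDerivAt (fun v : ℝ × ℝ => (1 + v.1) ^ (1 / q) * (1 + v.2) ^ (-(1 / p)))
      ((1 / q) • ContinuousLinearMap.fst ℝ ℝ ℝ - (1 / p) • ContinuousLinearMap.snd ℝ ℝ ℝ) 0 := by
  have h₁ : HasFDerivAt (fun v : ℝ × ℝ => (1 + v.1) ^ (1 / q)) _ 0 :=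
    (hasFDerivAt_fst.const_add 1).rpow_const (p := 1 / q) (Or.inl (by simp))
  have h₂ : HasFDerivAt (fun v : ℝ × ℝ => (1 + v.2) ^ (-(1 / p))) _ 0 :=
    (hasFDerivAt_snd.const_add 1).rpow_const (p := -(1 / p)) (Or.inl (by simp))
  refine (h₁.mul h₂).congr_fderiv ?_
  ext <;> simp

theorem normRatio_eq (hp : 1 ≤ p) (hq : 1 ≤ q) {n : ℕ} (hn : 0 < n) (x : Fin n → ℝ) :
    normRatio p q x = (1 + (n : ℝ)⁻¹ * ∑ i, centredPow p q (x i)) ^ (1 / q) *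
      (1 + (n : ℝ)⁻¹ * ∑ i, centredPow p p (x i)) ^ (-(1 / p)) := by
  have hn' : (0 : ℝ) < n := by exact_mod_cast hn
  have hsum : ∀ {s : ℝ}, 0 ≤ s → 1 + (n : ℝ)⁻¹ * ∑ i, centredPow p s (x i) =
      (∑ i, |x i| ^ s) / (n * Mp p s) := by
    intro s hs
    have := (Mp_pos hp hs).ne'
    simp only [centredPow, Finset.sum_sub_distrib, ← Finset.sum_div]
    simp
    field_simp
    ring
  have hS : ∀ s : ℝ, 0 ≤ ∑ i, |x i| ^ s := fun s => Finset.sum_nonneg fun i _ => by positivity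
  have hM := Mp_pos hp (zero_le_one.trans hq)
  rw [hsum (zero_le_one.trans hq), hsum (zero_le_one.trans hp), Mp_self hp, mul_one,
    Real.rpow_neg (div_nonneg (hS p) hn'.le), Real.div_rpow (hS q) (by positivity),
    Real.div_rpow (hS p) hn'.le, Real.mul_rpow hn'.le hM.le, inv_div]
  unfold normRatio pnorm mpq
  rw [Real.rpow_sub hn']
  ring

end NormRatio

section IndependentCoordinates

variable {p q : ℝ} {Ω : Type*} {m : MeasurableSpace Ω} {P : Measure Ω} {Y : ℕ → Ω → ℝ}

theorem memLp_comp_pGaussian {φ : ℝ → ℝ} (hφ : Measurable φ) (h : MemLp φ 2 (pGaussian p)) {j : ℕ}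
    (hlaw : ProbabilityTheory.HasLaw (Y j) (pGaussian p) P) :
    MemLp (fun ω => φ (Y j ω)) 2 P := by
  rw [← hlaw.map_eq] at h
  exact (memLp_map_measure_iff hφ.aestronglyMeasurable hlaw.aemeasurable).1 h

theorem boundedInMeasure_mean_centredPow [IsProbabilityMeasure P] (hp : 1 ≤ p) (hq : 0 ≤ q)
    (hlaw : ∀ j, ProbabilityTheory.HasLaw (Y j) (pGaussian p) P)
    (hindep : ProbabilityTheory.iIndepFun Y P) :
    BoundedInMeasure (fun _ => P) fun n ω =>
      Real.sqrt n * ((n : ℝ)⁻¹ * ∑ j : Fin n, centredPow p q (Y j ω)) := by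
  have hmean : ∫ ω, centredPow p q (Y 0 ω) ∂P = 0 :=
    ((hlaw 0).integral_comp measurable_centredPow.aestronglyMeasurable).trans
      (integral_centredPow hp hq)
  refine (boundedInMeasure_inv_sqrt_mul_sum
    (memLp_comp_pGaussian measurable_centredPow (memLp_centredPow hp hq) (hlaw 0)) hmean
    (hindep.comp _ fun _ => measurable_centredPow)
    fun j => ((hlaw j).identDistrib (hlaw 0)).comp measurable_centredPow).congr
    (Eventually.of_forall fun n ω => ?_)
  rw [← mul_assoc, ← div_eq_mul_inv, Real.sqrt_div_self,
    Fin.sum_univ_eq_sum_range fun j => centredPow p q (Y j ω)]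
  rfl

theorem boundedInMeasure_norm_means [IsProbabilityMeasure P] (hp : 1 ≤ p) (hq : 0 ≤ q)
    (hlaw : ∀ j, ProbabilityTheory.HasLaw (Y j) (pGaussian p) P)
    (hindep : ProbabilityTheory.iIndepFun Y P) :
    BoundedInMeasure (fun _ => P) fun n ω => Real.sqrt n *
      ‖((n : ℝ)⁻¹ * ∑ j : Fin n, centredPow p q (Y j ω),
        (n : ℝ)⁻¹ * ∑ j : Fin n, centredPow p p (Y j ω))‖ := by
  refine ((boundedInMeasure_mean_centredPow hp hq hlaw hindep).sup
    (boundedInMeasure_mean_centredPow hp (zero_le_one.trans hp) hlaw hindep)).congr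
    (Eventually.of_forall fun n ω => ?_)
  rw [Prod.norm_def, mul_max_of_nonneg _ _ (Real.sqrt_nonneg _), abs_mul (Real.sqrt n),
    abs_mul (Real.sqrt n), abs_of_nonneg (Real.sqrt_nonneg _)]
  rfl

theorem boundedInMeasure_normRatio [IsProbabilityMeasure P] (hp : 1 ≤ p) (hq : 1 ≤ q)
    (hlaw : ∀ j, ProbabilityTheory.HasLaw (Y j) (pGaussian p) P)
    (hindep : ProbabilityTheory.iIndepFun Y P) :
    BoundedInMeasure (fun _ => P) fun n ω => normRatio p q fun j : Fin n => Y j ω :=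
  ((boundedInMeasure_norm_means hp (zero_le_one.trans hq) hlaw hindep).comp_continuousAt
    (hasFDerivAt_ratio_rpow p q).continuousAt).congr
      ((eventually_gt_atTop 0).mono fun _ hn _ => (normRatio_eq hp hq hn _).symm)

theorem vanishes_normRatio_sub_sum_normScore [IsProbabilityMeasure P] (hp : 1 ≤ p) (hq : 1 ≤ q)
    (hlaw : ∀ j, ProbabilityTheory.HasLaw (Y j) (pGaussian p) P)
    (hindep : ProbabilityTheory.iIndepFun Y P) :
    VanishesInMeasure (fun _ => P) fun n ω =>
      Real.sqrt n * (normRatio p q (fun j : Fin n => Y j ω) - 1) -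
        (Real.sqrt n)⁻¹ * ∑ j ∈ Finset.range n, normScore p q (Y j ω) := by
  refine ((boundedInMeasure_norm_means hp (zero_le_one.trans hq) hlaw hindep
    ).vanishes_of_hasFDerivAt (hasFDerivAt_ratio_rpow p q)).congr
      ((eventually_gt_atTop 0).mono fun n hn ω => ?_)
  rw [normRatio_eq hp hq hn, ← Real.sqrt_div_self,
    ← Fin.sum_univ_eq_sum_range fun j => normScore p q (Y j ω)]
  simp [normScore, Finset.sum_sub_distrib, ← Finset.sum_div]
  ring

theorem tendsto_integral_cexp_sum_normScore [IsProbabilityMeasure P] (hp : 1 ≤ p)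
    (hlaw : ∀ j, ProbabilityTheory.HasLaw (Y j) (pGaussian p) P)
    (hindep : ProbabilityTheory.iIndepFun Y P) {ι : Type*} [Fintype ι] {q : ι → ℝ}
    (hq : ∀ i, 0 < q i) (u : ι → ℝ) :
    Tendsto (fun n : ℕ => ∫ ω, Complex.exp (((Real.sqrt n)⁻¹ *
        ∑ j ∈ Finset.range n, ∑ i, u i * normScore p (q i) (Y j ω) : ℝ) * Complex.I) ∂P) atTop
      (𝓝 (charFun (ProbabilityTheory.gaussianReal 0
        (∑ i, ∑ j, u i * covEntry p (q i) (q j) * u j).toNNReal) 1)) := by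
  set z : ℝ → ℝ := fun y => ∑ i, u i * normScore p (q i) y
  have hzm : Measurable z := Finset.measurable_fun_sum _ fun i _ => measurable_normScore.const_mul _
  have hzL : MemLp z 2 (pGaussian p) :=
    memLp_finsetSum _ fun i _ => (memLp_normScore hp (hq i).le).const_mul _
  have := isProbabilityMeasure_pGaussian hp
  have hmean : ∫ ω, z (Y 0 ω) ∂P = 0 := by
    refine ((hlaw 0).integral_comp hzm.aestronglyMeasurable).trans ?_
    rw [integral_finsetSum _ fun i _ =>
      ((memLp_normScore hp (hq i).le).integrable one_le_two).const_mul _]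
    simp [integral_const_mul, fun i => integral_normScore hp (hq i).le]
  have hident : ∀ j, ProbabilityTheory.IdentDistrib (fun ω => z (Y j ω)) (fun ω => z (Y 0 ω)) P P :=
    fun j => ((hlaw j).identDistrib (hlaw 0)).comp hzm
  have hvar : ProbabilityTheory.variance (fun ω => z (Y 0 ω)) P =
      ∑ i, ∑ j, u i * covEntry p (q i) (q j) * u j := by
    rw [← variance_sum_normScore hp hq u]
    exact (((hlaw 0).identDistrib ProbabilityTheory.HasLaw.id).comp hzm).variance_eq
  have hclt := ProbabilityTheory.tendstoInDistribution_inv_sqrt_mul_sum_sub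
    (X := fun j ω => z (Y j ω)) (P := P) (Y := id)
    ProbabilityTheory.HasLaw.id (memLp_comp_pGaussian hzm hzL (hlaw 0))
    (hindep.comp _ fun _ => hzm) hident
  have hchar := ProbabilityMeasure.tendsto_iff_tendsto_charFun.1 hclt.tendsto 1
  simp only [ProbabilityMeasure.coe_mk, Measure.map_id, hvar] at hchar
  refine hchar.congr fun n => ?_
  rw [charFun_apply_real, integral_map (hclt.forall_aemeasurable n) (by fun_prop)]
  simp only [hmean, mul_zero, sub_zero, Complex.ofReal_one, one_mul]
  rfl

theorem map_radial_eq_map_independent (hp : 1 ≤ p)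
    (hlaw : ∀ j, ProbabilityTheory.HasLaw (Y j) (pGaussian p) P)
    (hindep : ProbabilityTheory.iIndepFun Y P) {n : ℕ} (hn : 0 < n) {F : Type*}
    [MeasurableSpace F] {φ : (Fin n → ℝ) → F} (hφ : Measurable φ)
    (hhom : ∀ c : ℝ, 0 < c → ∀ x, φ (c • x) = φ x) {μ : Measure (Fin n → ℝ)}
    [IsProbabilityMeasure μ] {g : ℝ → ℝ≥0∞}
    (hrad : μ = volume.withDensity fun x => g (pnorm p x)) :
    μ.map φ = P.map fun ω => φ fun j => Y j ω := by
  have hpi := ProbabilityTheory.iIndepFun.hasLaw_pi (fun j : Fin n => hlaw j)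
    (hindep.precomp Fin.val_injective)
  have := isProbabilityMeasure_pGaussian hp
  have hG := pi_pGaussian_eq_withDensity hp n
  have h₁ : IsProbabilityMeasure (volume.withDensity fun x : Fin n → ℝ => g (pnorm p x)) := by
    rwa [← hrad]
  have h₂ : IsProbabilityMeasure (Measure.pi fun _ : Fin n => pGaussian p) := inferInstance
  rw [hG] at h₂
  rw [hrad, map_withDensity_pnorm_eq hn hp hφ hhom g fun r => ENNReal.ofReal
      ((2 * p ^ (1 / p) * Real.Gamma (1 + 1 / p))⁻¹ ^ n * Real.exp (-r ^ p / p)), ← hG, ← hpi.map_eq,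
    AEMeasurable.map_map_of_aemeasurable hφ.aemeasurable hpi.aemeasurable]
  rfl

end IndependentCoordinates

section Radial

variable {p q : ℝ}

theorem pnorm_smul (hq : 1 ≤ q) {n : ℕ} {c : ℝ} (hc : 0 < c) (x : Fin n → ℝ) :
    pnorm q (c • x) = c * pnorm q x := by
  have : Fact (1 ≤ ENNReal.ofReal q) := ⟨by simpa using hq⟩
  rw [pnorm_eq_norm_toLp hq, pnorm_eq_norm_toLp hq, WithLp.toLp_smul, norm_smul,
    Real.norm_of_nonneg hc.le]

theorem normRatio_smul (hp : 1 ≤ p) (hq : 1 ≤ q) {n : ℕ} {c : ℝ} (hc : 0 < c) (x : Fin n → ℝ) :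
    normRatio p q (c • x) = normRatio p q x := by
  unfold normRatio
  rw [pnorm_smul hp hc, pnorm_smul hq hc]
  field_simp

theorem pnorm_mul_normRatio (hp : 1 ≤ p) (hq : 1 ≤ q) {n : ℕ} (x : Fin n → ℝ) :
    pnorm p x * normRatio p q x = (n : ℝ) ^ (1 / p - 1 / q) * pnorm q x / mpq p q := by
  have : Fact (1 ≤ ENNReal.ofReal p) := ⟨by simpa using hp⟩
  have : Fact (1 ≤ ENNReal.ofReal q) := ⟨by simpa using hq⟩
  unfold normRatio
  by_cases h : pnorm p x = 0
  · have hx : x = 0 := by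
      rw [pnorm_eq_norm_toLp hp, norm_eq_zero] at h
      simpa using h
    have hq0 : pnorm q x = 0 := by
      rw [pnorm_eq_norm_toLp hq, hx]
      simp
    simp [h, hq0]
  · field_simp

theorem tendsto_integral_cexp_radial (hp : 1 ≤ p) {ι : Type*} [Fintype ι] {q : ι → ℝ}
    (hq : ∀ i, 1 ≤ q i) {μ : (n : ℕ) → Measure (Fin n → ℝ)} {g : ℕ → ℝ → ℝ≥0∞}
    (hrad : ∀ n, μ n = volume.withDensity fun x => g n (pnorm p x))
    [∀ n, IsProbabilityMeasure (μ n)]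
    (hshell : VanishesInMeasure μ fun n x => Real.sqrt n * (1 - pnorm p x)) (u : ι → ℝ) :
    Tendsto (fun n : ℕ => ∫ x, Complex.exp ((∑ i, u i * (Real.sqrt n *
        ((n : ℝ) ^ (1 / p - 1 / q i) * pnorm (q i) x / mpq p (q i) - 1)) : ℝ) * Complex.I) ∂μ n)
      atTop (𝓝 (charFun (ProbabilityTheory.gaussianReal 0
        (∑ i, ∑ j, u i * covEntry p (q i) (q j) * u j).toNNReal) 1)) := by
  have := isProbabilityMeasure_pGaussian hp
  obtain ⟨Ω, _, P, Y, hY, hlaw, hindep, _⟩ := ProbabilityTheory.exists_iid ℕ (pGaussian p)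
  have hYn : ∀ n : ℕ, Measurable fun ω (j : Fin n) => Y j ω := fun n =>
    measurable_pi_lambda _ fun j => hY j
  set H : (n : ℕ) → (Fin n → ℝ) → ℝ := fun n x =>
    ∑ i, u i * (Real.sqrt n * (normRatio p (q i) x - 1)) with hH
  have hHm : ∀ n, Measurable (H n) := fun n => Finset.measurable_fun_sum _ fun i _ =>
    ((measurable_normRatio.sub_const 1).const_mul _).const_mul _
  have hclt := tendsto_integral_cexp_sum_normScore hp hlaw hindep
    (fun i => zero_lt_one.trans_le (hq i)) u
  have hlin : VanishesInMeasure (fun _ => P) fun n ω => H n (fun j => Y j ω) -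
      (Real.sqrt n)⁻¹ * ∑ j ∈ Finset.range n, ∑ i, u i * normScore p (q i) (Y j ω) := by
    refine (VanishesInMeasure.sum Finset.univ fun i _ =>
      (vanishes_normRatio_sub_sum_normScore hp (hq i) hlaw hindep).const_mul (u i)).congr
        (Eventually.of_forall fun n ω => ?_)
    simp only [hH, mul_sub, Finset.sum_sub_distrib, Finset.mul_sum]
    rw [Finset.sum_comm (s := Finset.range n)]
    congr 1
    refine Finset.sum_congr rfl fun i _ => Finset.sum_congr rfl fun j _ => ?_
    ring
  have hHY : ∀ n, Measurable fun ω => H n fun j => Y j ω := fun n => (hHm n).comp (hYn n)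
  have hlinm : ∀ n : ℕ, Measurable fun ω => (Real.sqrt n)⁻¹ *
      ∑ j ∈ Finset.range n, ∑ i, u i * normScore p (q i) (Y j ω) := fun n =>
    (Finset.measurable_fun_sum _ fun j _ => Finset.measurable_fun_sum _ fun i _ =>
      (measurable_normScore.comp (hY j)).const_mul _).const_mul _
  have hiid := (hlin.tendsto_integral_cexp_sub hHY hlinm).add hclt
  have hHlim : Tendsto (fun n => ∫ x, Complex.exp (H n x * Complex.I) ∂μ n) atTop
      (𝓝 (charFun (ProbabilityTheory.gaussianReal 0
        (∑ i, ∑ j, u i * covEntry p (q i) (q j) * u j).toNNReal) 1)) := by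
    rw [zero_add] at hiid
    refine hiid.congr' ((eventually_gt_atTop 0).mono fun n hn => ?_)
    have hmap := map_radial_eq_map_independent hp hlaw hindep hn (hHm n)
      (fun c hc x => by simp only [hH, normRatio_smul hp (hq _) hc]) (hrad n)
    have hcont : Continuous fun t : ℝ => Complex.exp (t * Complex.I) := by fun_prop
    have h := integral_map (hHm n).aemeasurable (μ := μ n) hcont.aestronglyMeasurable
    rw [hmap, integral_map (hHY n).aemeasurable hcont.aestronglyMeasurable] at h
    rw [sub_add_cancel]
    exact h
  have hbdd : ∀ i, BoundedInMeasure μ fun n x => normRatio p (q i) x := fun i =>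
    (boundedInMeasure_normRatio hp (hq i) hlaw hindep).of_map_eq
      (fun n => (measurable_normRatio.comp (hYn n)).aemeasurable)
      (fun n => measurable_normRatio.aemeasurable)
      ((eventually_gt_atTop 0).mono fun n hn =>
        map_radial_eq_map_independent hp hlaw hindep hn measurable_normRatio
          (fun c hc x => normRatio_smul hp (hq i) hc x) (hrad n))
  have hdiff : VanishesInMeasure μ fun n x => (∑ i, u i * (Real.sqrt n *
      ((n : ℝ) ^ (1 / p - 1 / q i) * pnorm (q i) x / mpq p (q i) - 1))) - H n x := by
    refine (VanishesInMeasure.sum Finset.univ fun i _ =>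
      ((hbdd i).mul_vanishes hshell).const_mul (-u i)).congr
        (Eventually.of_forall fun n x => ?_)
    simp only [hH]
    rw [← Finset.sum_sub_distrib]
    refine Finset.sum_congr rfl fun i _ => ?_
    rw [← pnorm_mul_normRatio hp (hq i)]
    ring
  have hWm : ∀ n : ℕ, Measurable fun x : Fin n → ℝ => ∑ i, u i * (Real.sqrt n *
      ((n : ℝ) ^ (1 / p - 1 / q i) * pnorm (q i) x / mpq p (q i) - 1)) := fun n =>
    Finset.measurable_fun_sum _ fun i _ =>
      ((((measurable_pnorm.const_mul _).div_const _).sub_const 1).const_mul _).const_mul _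
  have hfin := (hdiff.tendsto_integral_cexp_sub hWm hHm).add hHlim
  simpa only [sub_add_cancel, zero_add] using hfin

end Radial

/-- The Cramér–Wold device: convergence of the characteristic functions of all linear marginals
implies convergence in distribution. -/
theorem tendsto_integral_of_tendsto_integral_cexp {k : ℕ} {Ω : ℕ → Type*}
    {m : ∀ n, MeasurableSpace (Ω n)} {μ : ∀ n, Measure (Ω n)} [∀ n, IsProbabilityMeasure (μ n)]
    {W : ∀ n, Ω n → Fin k → ℝ} (hW : ∀ n, Measurable (W n))
    {N : Measure (Fin k → ℝ)} [IsProbabilityMeasure N]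
    (h : ∀ u : Fin k → ℝ, Tendsto
      (fun n => ∫ x, Complex.exp ((∑ i, u i * W n x i : ℝ) * Complex.I) ∂μ n) atTop
      (𝓝 (charFun (N.map fun y => ∑ i, u i * y i) 1)))
    (f : BoundedContinuousFunction (Fin k → ℝ) ℝ) :
    Tendsto (fun n => ∫ x, f (W n x) ∂μ n) atTop (𝓝 (∫ y, f y ∂N)) := by
  have hm : Measurable (WithLp.toLp 2 : (Fin k → ℝ) → EuclideanSpace ℝ (Fin k)) :=
    WithLp.measurable_toLp 2 _
  have hWm : ∀ n, AEMeasurable (fun x => WithLp.toLp 2 (W n x)) (μ n) := fun n =>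
    (hm.comp (hW n)).aemeasurable
  set ν : ℕ → ProbabilityMeasure (EuclideanSpace ℝ (Fin k)) := fun n =>
    ⟨(μ n).map fun x => WithLp.toLp 2 (W n x), Measure.isProbabilityMeasure_map (hWm n)⟩ with hν
  set ν₀ : ProbabilityMeasure (EuclideanSpace ℝ (Fin k)) :=
    ⟨N.map (WithLp.toLp 2), Measure.isProbabilityMeasure_map hm.aemeasurable⟩ with hν₀
  have hlim : Tendsto ν atTop (𝓝 ν₀) := by
    refine ProbabilityMeasure.tendsto_of_tendsto_charFun fun t => ?_
    have hN : charFun (N.map fun y => ∑ i, t i * y i) 1 =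
        charFun (ν₀ : Measure (EuclideanSpace ℝ (Fin k))) t := by
      have hsum : Measurable fun y : Fin k → ℝ => ∑ i, t i * y i :=
        Finset.measurable_fun_sum _ fun i _ => (measurable_pi_apply i).const_mul _
      rw [charFun_apply_real, integral_map hsum.aemeasurable (by fun_prop), charFun_apply, hν₀,
        ProbabilityMeasure.coe_mk, integral_map hm.aemeasurable (by fun_prop)]
      simp [PiLp.inner_apply]
    refine (hN ▸ h t).congr fun n => ?_
    rw [charFun_apply, hν, ProbabilityMeasure.coe_mk, integral_map (hWm n) (by fun_prop)]
    simp [PiLp.inner_apply]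
  have hf := ProbabilityMeasure.tendsto_iff_forall_integral_tendsto.1 hlim
    (f.compContinuous ⟨WithLp.ofLp, PiLp.continuous_ofLp 2 _⟩)
  simp only [hν, hν₀, ProbabilityMeasure.coe_mk] at hf
  rw [integral_map hm.aemeasurable
    (BoundedContinuousFunction.continuous _).aestronglyMeasurable] at hf
  refine hf.congr fun n => ?_
  rw [integral_map (hWm n) (BoundedContinuousFunction.continuous _).aestronglyMeasurable]
  rfl

/-- Multivariate central limit theorem for the `q_i`-norms of a continuous `p`-radial
random vector satisfying the thin-shell condition `√n(1 − ‖X^{(n)}‖_p) → 0` in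
probability. The limit is a centred Gaussian vector `N` with covariance matrix
`(c_{i,j})`, characterized by the fact that each linear marginal `⟨u, N⟩` is a centred
Gaussian with variance `uᵀ Σ u`. Convergence in distribution is expressed by
convergence of integrals of bounded continuous test functions. -/
theorem multivariate_clt_radial (k : ℕ) (p : ℝ) (hp : 1 ≤ p)
    (q : Fin k → ℝ) (hq : ∀ i, 1 ≤ q i) (hqp : ∀ i, q i ≠ p)
    -- `μ n` is the distribution of the continuous `p`-radial random vector `X^{(n)}`:
    (μ : (n : ℕ) → Measure (Fin n → ℝ)) (g : (n : ℕ) → ℝ → ℝ≥0∞)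
    (hrad : ∀ n, μ n = volume.withDensity (fun x => g n (pnorm p x)))
    (hprob : ∀ n, IsProbabilityMeasure (μ n))
    -- thin-shell condition: `√n (1 − ‖X^{(n)}‖_p) → 0` in probability:
    (hshell : ∀ ε : ℝ, 0 < ε →
      Tendsto (fun n : ℕ => μ n {x | ε ≤ |Real.sqrt n * (1 - pnorm p x)|}) atTop (𝓝 0))
    -- `N` is a centred Gaussian measure on `ℝ^k` with covariance matrix `(c_{i,j})`:
    (N : Measure (Fin k → ℝ)) (hNprob : IsProbabilityMeasure N)
    (hNgauss : ∀ u : Fin k → ℝ,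
      Measure.map (fun y => ∑ i, u i * y i) N =
        ProbabilityTheory.gaussianReal 0
          ((∑ i, ∑ j, u i * covEntry p (q i) (q j) * u j).toNNReal)) :
    ∀ f : BoundedContinuousFunction (Fin k → ℝ) ℝ,
      Tendsto (fun n : ℕ =>
          ∫ x, f (fun i =>
            Real.sqrt n *
              ((n : ℝ) ^ (1 / p - 1 / q i) * pnorm (q i) x / mpq p (q i) - 1)) ∂(μ n))
        atTop (𝓝 (∫ y, f y ∂N)) := by
  intro f
  refine tendsto_integral_of_tendsto_integral_cexp
    (W := fun n x i => Real.sqrt n *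
      ((n : ℝ) ^ (1 / p - 1 / q i) * pnorm (q i) x / mpq p (q i) - 1))
    (fun n => measurable_pi_lambda _ fun i =>
      (((measurable_pnorm.const_mul _).div_const _).sub_const 1).const_mul _) (fun u => ?_) f
  rw [hNgauss u]
  exact tendsto_integral_cexp_radial hp hq hrad hshell u
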